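/- arXiv:1812.00688 — 5 statements merged into one kernel-verified Lean document; each statement's English description precedes it below -/
import Mathlib

section
/- Let n1, n2, n3, r be positive natural numbers. For i ∈ Fin r let a_i : Fin n1 → ℂ, b_i : Fin n2 → ℂ, c_i : ZMod n3 → ℂ, and define X : Fin n1 → Fin n2 → ZMod n3 → ℂ by X(p,q,s) = ∑_{i ∈ Fin r} a_i(p)·b_i(q)·c_i(s). Assume the family (a_i)_{i ∈ Fin r} is linearly independent in (Fin n1 → ℂ), the family (b_i)_{i ∈ Fin r} is linearly independent in (Fin n2 → ℂ), and for every i ∈ Fin r and every k ∈ ZMod n3 the DFT coefficient ĉ_i(k) = ∑_{s ∈ ZMod n3} c_i(s)·exp(−2πI·(k·s)/n3) is nonzero. Then for every k ∈ ZMod n3, the matrix X̂_k with entries X̂_k(p,q) = ∑_{s ∈ ZMod n3} X(p,q,s)·exp(−2πI·(k·s)/n3) has rank exactly r. -/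
/-- The DFT kernel `exp(−2πI·(k·s)/n)`, with `k·s` evaluated via integer
representatives. -/
noncomputable def dftKernel (n : ℕ) (k s : ZMod n) : ℂ :=
  Complex.exp (-(2 * Real.pi * Complex.I * ((k.val * s.val : ℕ) : ℂ) / (n : ℂ)))

/-- Multiplying on the left by a matrix with linearly independent columns preserves the rank. -/
theorem Matrix.rank_mul_of_linearIndependent_col {K l m n : Type*} [Field K] [Fintype m]
    [Fintype n] (A : Matrix l m K) (B : Matrix m n K) (hA : LinearIndependent K A.col) :
    (A * B).rank = B.rank := by
  have hinj : Function.Injective A.mulVecLin := Matrix.mulVec_injective_iff.mpr hA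
  rw [Matrix.rank, Matrix.rank, Matrix.mulVecLin_mul, LinearMap.range_comp]
  exact (Submodule.equivMapOfInjective _ hinj _).finrank_eq.symm

/-- If a three-way tensor `X` has a CP decomposition into `r` rank-one terms
with linearly independent factor families `a` and `b`, and all the DFT
coefficients of the tubes `c i` are nonzero, then every frontal slice of the
DFT of `X` along its third mode has rank exactly `r`. -/
theorem tubal_rank_eq_of_cp_decomposition
    (n1 n2 n3 r : ℕ) (hn1 : 0 < n1) (hn2 : 0 < n2) [NeZero n3] (hr : 0 < r)
    (a : Fin r → Fin n1 → ℂ) (b : Fin r → Fin n2 → ℂ) (c : Fin r → ZMod n3 → ℂ)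
    (X : Fin n1 → Fin n2 → ZMod n3 → ℂ)
    (hX : ∀ p q s, X p q s = ∑ i : Fin r, a i p * b i q * c i s)
    (ha : LinearIndependent ℂ a) (hb : LinearIndependent ℂ b)
    (hc : ∀ (i : Fin r) (k : ZMod n3),
      (∑ s : ZMod n3, c i s * dftKernel n3 k s) ≠ 0)
    (k : ZMod n3) :
    Matrix.rank (Matrix.of fun (p : Fin n1) (q : Fin n2) =>
      ∑ s : ZMod n3, X p q s * dftKernel n3 k s) = r := by
  set B : Matrix (Fin r) (Fin n2) ℂ :=
    Matrix.of fun i q => (∑ s : ZMod n3, c i s * dftKernel n3 k s) * b i q with hB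
  have hfac : (Matrix.of fun (p : Fin n1) (q : Fin n2) =>
      ∑ s : ZMod n3, X p q s * dftKernel n3 k s) = (Matrix.of a).transpose * B := by
    ext p q
    simp only [hB, Matrix.mul_apply, Matrix.transpose_apply, Matrix.of_apply, hX,
      Finset.sum_mul, Finset.mul_sum]
    rw [Finset.sum_comm]
    exact Finset.sum_congr rfl fun i _ => Finset.sum_congr rfl fun s _ => by ring
  have hBli : LinearIndependent ℂ B.row :=
    hb.units_smul fun i => Units.mk0 _ (hc i k)
  rw [hfac, Matrix.rank_mul_of_linearIndependent_col (Matrix.of a).transpose B ha,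
    hBli.rank_matrix, Fintype.card_fin]
end

section
/- Let N and r be positive natural numbers, let n : Fin N → ℕ be positive in each coordinate, and let X : (∀ k : Fin N, Fin (n k)) → ℂ be an N-way tensor admitting the CP decomposition X(idx) = ∑_{i ∈ Fin r} ∏_{k : Fin N} a_i^k(idx k), where a_i^k : Fin (n k) → ℂ. Fix two distinct modes k1 ≠ k2 in Fin N. Then for every complex weight function w : ((∀ k : Fin N, Fin (n k))) → ℂ that depends only on the coordinates other than k1 and k2 (i.e., w(idx) = w(idx') whenever idx k = idx' k for all k ≠ k1, k2), the n_{k1} × n_{k2} matrix M defined by M(p,q) = ∑_{rest : ∀ k ∈ {k : k ≠ k1, k ≠ k2}, Fin (n k)} w(combine(p,q,rest)) · X(combine(p,q,rest)) has rank at most r, where combine(p,q,rest) is the index function equal to p at k1, q at k2, and rest(k) at every other mode k. In particular, every frontal slice of the DFT along the third mode of the mode-k1k2 unfolding of X has rank at most r, so every entry of the N-tubal rank of X is at most r. -/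
/-- Combine a mode-`k1` index `p`, a mode-`k2` index `q`, and indices `rest`
for all the remaining modes into a full multi-index of an `N`-way tensor. -/
def combineIdx {N : ℕ} {n : Fin N → ℕ} (k1 k2 : Fin N)
    (p : Fin (n k1)) (q : Fin (n k2))
    (rest : ∀ k : {k : Fin N // k ≠ k1 ∧ k ≠ k2}, Fin (n k.1)) :
    ∀ k : Fin N, Fin (n k) := fun k =>
  if h1 : k = k1 then h1.symm ▸ p
  else if h2 : k = k2 then h2.symm ▸ q
  else rest ⟨k, h1, h2⟩

@[simp]
lemma combineIdx_left {N : ℕ} {n : Fin N → ℕ} (k1 k2 : Fin N)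
    (p : Fin (n k1)) (q : Fin (n k2))
    (rest : ∀ k : {k : Fin N // k ≠ k1 ∧ k ≠ k2}, Fin (n k.1)) :
    combineIdx k1 k2 p q rest k1 = p := by
  simp [combineIdx]

lemma combineIdx_right {N : ℕ} {n : Fin N → ℕ} {k1 k2 : Fin N} (hk : k1 ≠ k2)
    (p : Fin (n k1)) (q : Fin (n k2))
    (rest : ∀ k : {k : Fin N // k ≠ k1 ∧ k ≠ k2}, Fin (n k.1)) :
    combineIdx k1 k2 p q rest k2 = q := by
  simp [combineIdx, hk.symm]

lemma combineIdx_of_ne {N : ℕ} {n : Fin N → ℕ} {k1 k2 k : Fin N} (h1 : k ≠ k1) (h2 : k ≠ k2)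
    (p : Fin (n k1)) (q : Fin (n k2))
    (rest : ∀ k : {k : Fin N // k ≠ k1 ∧ k ≠ k2}, Fin (n k.1)) :
    combineIdx k1 k2 p q rest k = rest ⟨k, h1, h2⟩ := by
  simp [combineIdx, h1, h2]

lemma Fintype.prod_eq_mul_mul_prod_subtype {ι M : Type*} [Fintype ι] [DecidableEq ι]
    [CommMonoid M] {i j : ι} (hij : i ≠ j) (f : ι → M) :
    ∏ k, f k = f i * (f j * ∏ k : {k // k ≠ i ∧ k ≠ j}, f k) := by
  rw [← Finset.mul_prod_erase Finset.univ f (Finset.mem_univ i),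
    ← Finset.mul_prod_erase (Finset.univ.erase i) f (a := j) (by simp [hij.symm]),
    Finset.prod_subtype _ (p := fun k => k ≠ i ∧ k ≠ j) (by simp [and_comm])]

lemma prod_combineIdx {N : ℕ} {n : Fin N → ℕ} {M : Type*} [CommMonoid M] {k1 k2 : Fin N}
    (hk : k1 ≠ k2) (f : ∀ k : Fin N, Fin (n k) → M) (p : Fin (n k1)) (q : Fin (n k2))
    (rest : ∀ k : {k : Fin N // k ≠ k1 ∧ k ≠ k2}, Fin (n k.1)) :
    ∏ k, f k (combineIdx k1 k2 p q rest k) = f k1 p * (f k2 q * ∏ k, f k.1 (rest k)) := by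
  rw [Fintype.prod_eq_mul_mul_prod_subtype hk, combineIdx_left, combineIdx_right hk]
  congr 2
  exact Finset.prod_congr rfl fun k _ => by rw [combineIdx_of_ne k.2.1 k.2.2]

/-- If an `N`-way tensor `X` has a CP decomposition into `r` rank-one terms,
then for any two distinct modes `k1 ≠ k2` and any weight function `w`
depending only on the remaining modes, the `n k1 × n k2` matrix obtained by
the `w`-weighted sum of the mode-`k1k2` slices of `X` has rank at most `r`.
In particular every frontal slice of the DFT along the third mode of the
mode-`k1k2` unfolding of `X` has rank at most `r`, so every entry of the
`N`-tubal rank of `X` is at most `r`. -/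
theorem rank_weighted_slice_sum_le_of_cp
    (N r : ℕ) (hN : 0 < N) (hr : 0 < r) (n : Fin N → ℕ) (hn : ∀ k, 0 < n k)
    (X : (∀ k : Fin N, Fin (n k)) → ℂ)
    (a : Fin r → ∀ k : Fin N, Fin (n k) → ℂ)
    (hX : ∀ idx, X idx = ∑ i : Fin r, ∏ k : Fin N, a i k (idx k))
    (k1 k2 : Fin N) (hk : k1 ≠ k2)
    (w : (∀ k : Fin N, Fin (n k)) → ℂ)
    (hw : ∀ idx idx' : ∀ k : Fin N, Fin (n k),
      (∀ k, k ≠ k1 → k ≠ k2 → idx k = idx' k) → w idx = w idx') :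
    Matrix.rank (Matrix.of fun (p : Fin (n k1)) (q : Fin (n k2)) =>
      ∑ rest : ∀ k : {k : Fin N // k ≠ k1 ∧ k ≠ k2}, Fin (n k.1),
        w (combineIdx k1 k2 p q rest) * X (combineIdx k1 k2 p q rest)) ≤ r := by
  let p₀ : Fin (n k1) := ⟨0, hn k1⟩
  let q₀ : Fin (n k2) := ⟨0, hn k2⟩
  let A : Matrix (Fin (n k1)) (Fin r) ℂ := Matrix.of fun p i => a i k1 p
  let B : Matrix (Fin r) (Fin (n k2)) ℂ := Matrix.of fun i q =>
    a i k2 q * ∑ rest : ∀ k : {k : Fin N // k ≠ k1 ∧ k ≠ k2}, Fin (n k.1),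
      w (combineIdx k1 k2 p₀ q₀ rest) * ∏ k, a i k.1 (rest k)
  have hw₀ (p q rest) : w (combineIdx k1 k2 p q rest) = w (combineIdx k1 k2 p₀ q₀ rest) :=
    hw _ _ fun k h1 h2 => by simp only [combineIdx_of_ne h1 h2]
  have hM : (Matrix.of fun (p : Fin (n k1)) (q : Fin (n k2)) =>
      ∑ rest : ∀ k : {k : Fin N // k ≠ k1 ∧ k ≠ k2}, Fin (n k.1),
        w (combineIdx k1 k2 p q rest) * X (combineIdx k1 k2 p q rest)) = A * B := by
    ext p q
    simp only [Matrix.of_apply, Matrix.mul_apply, A, B, hX, prod_combineIdx hk, hw₀ p q,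
      Finset.mul_sum]
    rw [Finset.sum_comm]
    exact Finset.sum_congr rfl fun i _ => Finset.sum_congr rfl fun rest _ => by ring
  rw [hM]
  exact (Matrix.rank_mul_le_left A B).trans A.rank_le_width
end

section
/- (t-SVD) Let p, m, n be positive natural numbers and let X : ZMod p → Matrix (Fin m) (Fin n) ℝ be an arbitrary real three-way tensor given by its frontal slices. Then there exist U : ZMod p → Matrix (Fin m) (Fin m) ℝ, S : ZMod p → Matrix (Fin m) (Fin n) ℝ, and V : ZMod p → Matrix (Fin n) (Fin n) ℝ such that: (1) X = U ⋆ S ⋆ Vᵀ, where ⋆ is the t-product (A ⋆ B)(s) = ∑_{t ∈ ZMod p} A(t) * B(s − t) and Vᵀ is the tensor transpose Vᵀ(s) = (V(−s))ᵀ; (2) U is orthogonal: U ⋆ Uᵀ = Uᵀ ⋆ U = E_m, and likewise V ⋆ Vᵀ = Vᵀ ⋆ V = E_n, where E_m is the identity tensor with E_m(0) = 1 (the m × m identity matrix) and E_m(s) = 0 for s ≠ 0; (3) S is f-diagonal: for every s ∈ ZMod p and indices i ∈ Fin m, j ∈ Fin n with (i : ℕ) ≠ (j : ℕ), S(s)(i,j)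 = 0. -/
/-- The t-product of two real three-way tensors given by their frontal slices:
blockwise circular convolution of the frontal slices. -/
noncomputable def tProd {p m n q : ℕ} [NeZero p]
    (A : ZMod p → Matrix (Fin m) (Fin n) ℝ)
    (B : ZMod p → Matrix (Fin n) (Fin q) ℝ) :
    ZMod p → Matrix (Fin m) (Fin q) ℝ :=
  fun s => ∑ t : ZMod p, A t * B (s - t)

/-- The tensor transpose: each frontal slice is transposed and the order of the
transposed slices `2` through `p` is reversed, i.e. `Aᵀ(s) = (A(−s))ᵀ`. -/
def tTranspose {p m n : ℕ} (A : ZMod p → Matrix (Fin m) (Fin n) ℝ) :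
    ZMod p → Matrix (Fin n) (Fin m) ℝ :=
  fun s => (A (-s)).transpose

/-- The identity tensor: the first frontal slice is the identity matrix and all
other frontal slices are zero. -/
def tId (p m : ℕ) [NeZero p] : ZMod p → Matrix (Fin m) (Fin m) ℝ :=
  fun s => if s = 0 then 1 else 0

/-- A tensor is f-diagonal if each of its frontal slices is a diagonal matrix. -/
def FDiagonal {p m n : ℕ} (S : ZMod p → Matrix (Fin m) (Fin n) ℝ) : Prop :=
  ∀ (s : ZMod p) (i : Fin m) (j : Fin n), (i : ℕ) ≠ (j : ℕ) → S s i j = 0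

section SingularValueDecomposition

variable {𝕜 E F : Type*} [RCLike 𝕜] [NormedAddCommGroup E] [InnerProductSpace 𝕜 E]
  [NormedAddCommGroup F] [InnerProductSpace 𝕜 F] [FiniteDimensional 𝕜 E] [FiniteDimensional 𝕜 F]

/-- A linear map between finite-dimensional inner product spaces is diagonal with respect to
suitable orthonormal bases. -/
theorem LinearMap.exists_orthonormalBasis_inner_eq_zero {m n : ℕ}
    (hE : Module.finrank 𝕜 E = n) (hF : Module.finrank 𝕜 F = m) (T : E →ₗ[𝕜] F) :
    ∃ (u : OrthonormalBasis (Fin m) 𝕜 F) (v : OrthonormalBasis (Fin n) 𝕜 E),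
      ∀ (i : Fin m) (j : Fin n), (i : ℕ) ≠ (j : ℕ) → inner 𝕜 (u i) (T (v j)) = 0 := by
  have hsymm := T.isSymmetric_adjoint_comp_self
  set v := hsymm.eigenvectorBasis hE
  have hinner (i j : Fin n) : inner 𝕜 (T (v i)) (T (v j)) =
      (hsymm.eigenvalues hE j : 𝕜) * inner 𝕜 (v i) (v j) := by
    rw [← inner_smul_right, ← hsymm.apply_eigenvectorBasis hE j, LinearMap.comp_apply,
      LinearMap.adjoint_inner_right]
  have horth (i j : Fin n) (hij : i ≠ j) : inner 𝕜 (T (v i)) (T (v j)) = 0 := by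
    rw [hinner, v.inner_eq_zero hij, mul_zero]
  have hnorm (i : Fin n) : hsymm.eigenvalues hE i = ‖T (v i)‖ ^ 2 := by
    have h := hinner i i
    rw [inner_self_eq_norm_sq_to_K, inner_self_eq_norm_sq_to_K, v.norm_eq_one] at h
    have h' : ((‖T (v i)‖ ^ 2 : ℝ) : 𝕜) = (hsymm.eigenvalues hE i : 𝕜) := by simpa using h
    exact_mod_cast h'.symm
  have hlt (j : Fin n) (hj : T (v j) ≠ 0) : (j : ℕ) < m := by
    have hli : LinearIndependent 𝕜 fun i : Fin (j + 1) => T (v (i.castLE j.2)) := by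
      refine linearIndependent_of_ne_zero_of_inner_eq_zero (fun i hi => hj ?_) fun i k hik =>
        horth _ _ fun h => hik (Fin.castLE_injective _ h)
      have hle := hsymm.eigenvalues_antitone hE (show i.castLE j.2 ≤ j from Nat.le_of_lt_succ i.2)
      rw [hnorm, hnorm, hi] at hle
      have : ‖T (v j)‖ ^ 2 = 0 := le_antisymm (by simpa using hle) (sq_nonneg _)
      simpa using this
    simpa [hF] using hli.fintype_card_le_finrank
  let w : Fin m → F := fun i =>
    if h : (i : ℕ) < n then (‖T (v ⟨i, h⟩)‖ : 𝕜)⁻¹ • T (v ⟨i, h⟩) else 0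
  let s : Set (Fin m) := {i | ∃ h : (i : ℕ) < n, T (v ⟨i, h⟩) ≠ 0}
  have hw : Orthonormal 𝕜 (s.domRestrict w) := by
    constructor
    · rintro ⟨i, h, hi⟩
      simp [w, h, norm_smul, hi]
    · rintro ⟨i, h, hi⟩ ⟨k, h', hk⟩ hik
      have : (⟨i, h⟩ : Fin n) ≠ ⟨k, h'⟩ := by
        simpa [Fin.ext_iff] using hik
      simp [w, h, h', inner_smul_left, inner_smul_right, horth _ _ this]
  obtain ⟨u, hu⟩ := hw.exists_orthonormalBasis_extension_of_card_eq (by simpa using hF)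
  refine ⟨u, v, fun i j hij => ?_⟩
  by_cases hj : T (v j) = 0
  · rw [hj, inner_zero_right]
  have huj : u ⟨j, hlt j hj⟩ = (‖T (v j)‖ : 𝕜)⁻¹ • T (v j) := by
    rw [hu _ ⟨j.2, hj⟩]
    simp [w]
  have hT : T (v j) = (‖T (v j)‖ : 𝕜) • u ⟨j, hlt j hj⟩ := by
    rw [huj, smul_inv_smul₀]
    simpa using hj
  rw [hT, inner_smul_right, u.inner_eq_zero, mul_zero]
  simpa [Fin.ext_iff] using hij

/-- Singular value decomposition of a rectangular matrix, with no normalization of the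
diagonal factor. -/
theorem Matrix.exists_unitary_mul_diagonal {m n : ℕ} (A : Matrix (Fin m) (Fin n) 𝕜) :
    ∃ U ∈ Matrix.unitaryGroup (Fin m) 𝕜, ∃ S : Matrix (Fin m) (Fin n) 𝕜,
      ∃ V ∈ Matrix.unitaryGroup (Fin n) 𝕜, A = U * S * V.conjTranspose ∧
        ∀ (i : Fin m) (j : Fin n), (i : ℕ) ≠ (j : ℕ) → S i j = 0 := by
  obtain ⟨u, v, h⟩ := LinearMap.exists_orthonormalBasis_inner_eq_zero (𝕜 := 𝕜)
    (finrank_euclideanSpace_fin (n := n)) (finrank_euclideanSpace_fin (n := m)) A.toEuclideanLin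
  let U := (EuclideanSpace.basisFun (Fin m) 𝕜).toBasis.toMatrix u
  let V := (EuclideanSpace.basisFun (Fin n) 𝕜).toBasis.toMatrix v
  have hU : U ∈ Matrix.unitaryGroup (Fin m) 𝕜 :=
    OrthonormalBasis.toMatrix_orthonormalBasis_mem_unitary _ _
  have hV : V ∈ Matrix.unitaryGroup (Fin n) 𝕜 :=
    OrthonormalBasis.toMatrix_orthonormalBasis_mem_unitary _ _
  refine ⟨U, hU, U.conjTranspose * (A * V), V, hV, ?_, fun i j hij => ?_⟩
  · have hU' : U * U.conjTranspose = 1 := Matrix.mem_unitaryGroup_iff.mp hU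
    have hV' : V * V.conjTranspose = 1 := Matrix.mem_unitaryGroup_iff.mp hV
    rw [← Matrix.mul_assoc, hU', Matrix.one_mul, Matrix.mul_assoc, hV', Matrix.mul_one]
  · rw [← h i j hij]
    simp [U, V, Matrix.mul_apply, Module.Basis.toMatrix_apply, PiLp.inner_apply, Matrix.mulVec,
      dotProduct, mul_comm]

end SingularValueDecomposition

theorem Matrix.map_conj_mem_unitaryGroup {n : Type*} [Fintype n] [DecidableEq n]
    {U : Matrix n n ℂ} (hU : U ∈ Matrix.unitaryGroup n ℂ) :
    U.map (starRingEnd ℂ) ∈ Matrix.unitaryGroup n ℂ := by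
  have h : star (U.map (starRingEnd ℂ)) = (star U).map (starRingEnd ℂ) := by
    ext i j
    simp [Matrix.star_apply]
  rw [Matrix.mem_unitaryGroup_iff] at hU ⊢
  rw [h, ← Matrix.map_mul, hU, Matrix.map_one _ (map_zero _) (map_one _)]

theorem Matrix.map_ofReal_mem_unitaryGroup {n : Type*} [Fintype n] [DecidableEq n]
    {U : Matrix n n ℝ} (hU : U ∈ Matrix.unitaryGroup n ℝ) :
    U.map Complex.ofRealHom ∈ Matrix.unitaryGroup n ℂ := by
  have h : star (U.map Complex.ofRealHom) = (star U).map Complex.ofRealHom := by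
    ext i j
    simp [Matrix.star_apply]
  rw [Matrix.mem_unitaryGroup_iff] at hU ⊢
  rw [h, ← Matrix.map_mul, hU, Matrix.map_one _ (map_zero _) (map_one _)]

/-- Pointwise solvable conditions on a function on `ZMod p`, compatible with an involution `c`,
have a solution intertwining negation with `c`. -/
theorem ZMod.exists_forall_map_neg_eq {p : ℕ} [NeZero p] {α : Type*} {P : ZMod p → α → Prop}
    {c : α → α} (hc : Function.Involutive c) (hP : ∀ k a, P k a → P (-k) (c a))
    (h : ∀ k, ∃ a, P k a ∧ (-k = k → c a = a)) :
    ∃ f : ZMod p → α, (∀ k, P k (f k)) ∧ ∀ k, f (-k) = c (f k) := by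
  choose g hg hfix using h
  refine ⟨fun k => if k.val ≤ (-k).val then g k else c (g (-k)), fun k => ?_, fun k => ?_⟩
  · dsimp only
    split_ifs
    · exact hg k
    · simpa using hP _ _ (hg (-k))
  · dsimp only
    rw [neg_neg]
    rcases lt_trichotomy k.val (-k).val with hk | hk | hk
    · rw [if_neg hk.not_ge, if_pos hk.le]
    · have hk' : -k = k := (ZMod.val_injective p hk).symm
      simp [hk', hfix k hk']
    · rw [if_pos hk.le, if_neg hk.not_ge, hc]

section Fourier

open ZMod

variable {p m n q : ℕ} [NeZero p]

/-- The discrete Fourier transform of a real tensor along its third mode. -/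
noncomputable def tFourier (A : ZMod p → Matrix (Fin m) (Fin n) ℝ) :
    ZMod p → Matrix (Fin m) (Fin n) ℂ :=
  dft fun s => (A s).map Complex.ofRealHom

theorem tFourier_apply (A : ZMod p → Matrix (Fin m) (Fin n) ℝ) (k : ZMod p) :
    tFourier A k = ∑ s, stdAddChar (-(s * k)) • (A s).map Complex.ofRealHom :=
  rfl

theorem tFourier_injective :
    Function.Injective (tFourier : (ZMod p → Matrix (Fin m) (Fin n) ℝ) → _) := fun A B h => by
  have h' := dft.injective h
  ext s i j
  simpa using congrFun (congrFun (congrFun h' s) i) j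

theorem tFourier_tProd (A : ZMod p → Matrix (Fin m) (Fin n) ℝ)
    (B : ZMod p → Matrix (Fin n) (Fin q) ℝ) (k : ZMod p) :
    tFourier (tProd A B) k = tFourier A k * tFourier B k := by
  have hmap (s : ZMod p) : (tProd A B s).map Complex.ofRealHom =
      ∑ t, (A t).map Complex.ofRealHom * (B (s - t)).map Complex.ofRealHom := by
    ext i j
    simp [tProd, Matrix.sum_apply, Matrix.mul_apply]
  simp only [tFourier_apply, hmap, Finset.smul_sum]
  rw [Finset.sum_comm, Matrix.sum_mul]
  simp only [Matrix.mul_sum]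
  refine Finset.sum_congr rfl fun t _ => ?_
  refine Fintype.sum_equiv (Equiv.subRight t) _ _ fun s => ?_
  rw [Matrix.smul_mul, Matrix.mul_smul, smul_smul, ← AddChar.map_add_eq_mul, Equiv.subRight_apply]
  congr 2
  ring

theorem tFourier_tTranspose (A : ZMod p → Matrix (Fin m) (Fin n) ℝ) (k : ZMod p) :
    tFourier (tTranspose A) k = (tFourier A k).conjTranspose := by
  rw [tFourier_apply, tFourier_apply, Matrix.conjTranspose_sum]
  refine Fintype.sum_equiv (Equiv.neg _) _ _ fun s => ?_
  ext i j
  simp [tTranspose, ← AddChar.map_neg_eq_conj]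

theorem tFourier_tId (k : ZMod p) : tFourier (tId p m) k = 1 := by
  rw [tFourier_apply, Finset.sum_eq_single 0]
  · simp [tId]
  · intro s _ hs
    simp [tId, hs]
  · simp

theorem tFourier_neg (A : ZMod p → Matrix (Fin m) (Fin n) ℝ) (k : ZMod p) :
    tFourier A (-k) = (tFourier A k).map (starRingEnd ℂ) := by
  ext i j
  simp [tFourier_apply, Matrix.sum_apply, ← AddChar.map_neg_eq_conj]

/-- The real part of the inverse discrete Fourier transform of a complex tensor along its third
mode. -/
noncomputable def tInvFourier (G : ZMod p → Matrix (Fin m) (Fin n) ℂ) :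
    ZMod p → Matrix (Fin m) (Fin n) ℝ :=
  fun s => (dft.symm G s).map Complex.re

theorem tFourier_tInvFourier {G : ZMod p → Matrix (Fin m) (Fin n) ℂ}
    (hG : ∀ k, G (-k) = (G k).map (starRingEnd ℂ)) : tFourier (tInvFourier G) = G := by
  have hreal : (fun s => (tInvFourier G s).map Complex.ofRealHom) = dft.symm G := by
    ext s i j
    simp only [tInvFourier, Matrix.map_apply, Complex.ofRealHom_eq_coe]
    rw [← Complex.conj_eq_iff_re, invDFT_apply]
    simp only [Matrix.smul_apply, Matrix.sum_apply, smul_eq_mul, map_mul, map_sum, map_inv₀,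
      map_natCast]
    congr 1
    refine Fintype.sum_equiv (Equiv.neg _) _ _ fun k => ?_
    simp [hG, ← AddChar.map_neg_eq_conj]
  rw [tFourier, hreal, LinearEquiv.apply_symm_apply]

theorem tInvFourier_fDiagonal {G : ZMod p → Matrix (Fin m) (Fin n) ℂ}
    (hG : ∀ k (i : Fin m) (j : Fin n), (i : ℕ) ≠ (j : ℕ) → G k i j = 0) :
    FDiagonal (tInvFourier G) := by
  intro s i j hij
  simp [tInvFourier, invDFT_apply, Matrix.sum_apply, hG _ i j hij]

theorem tProd_tTranspose_self_of_tFourier_mem_unitaryGroup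
    {U : ZMod p → Matrix (Fin m) (Fin m) ℝ}
    (hU : ∀ k, tFourier U k ∈ Matrix.unitaryGroup (Fin m) ℂ) :
    tProd U (tTranspose U) = tId p m ∧ tProd (tTranspose U) U = tId p m := by
  constructor <;> refine tFourier_injective (funext fun k => ?_) <;>
    rw [tFourier_tProd, tFourier_tTranspose, tFourier_tId]
  · exact Matrix.mem_unitaryGroup_iff.mp (hU k)
  · exact Matrix.mem_unitaryGroup_iff'.mp (hU k)

end Fourier

/-- t-SVD: every real three-way tensor `X` factors as `X = U ⋆ S ⋆ Vᵀ` with `U`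
and `V` orthogonal tensors and `S` f-diagonal. -/
theorem tSVD (p m n : ℕ) [NeZero p] (hm : 0 < m) (hn : 0 < n)
    (X : ZMod p → Matrix (Fin m) (Fin n) ℝ) :
    ∃ (U : ZMod p → Matrix (Fin m) (Fin m) ℝ)
      (S : ZMod p → Matrix (Fin m) (Fin n) ℝ)
      (V : ZMod p → Matrix (Fin n) (Fin n) ℝ),
      X = tProd (tProd U S) (tTranspose V) ∧
      tProd U (tTranspose U) = tId p m ∧ tProd (tTranspose U) U = tId p m ∧
      tProd V (tTranspose V) = tId p n ∧ tProd (tTranspose V) V = tId p n ∧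
      FDiagonal S := by
  let c : Matrix (Fin m) (Fin m) ℂ × Matrix (Fin m) (Fin n) ℂ × Matrix (Fin n) (Fin n) ℂ →
      Matrix (Fin m) (Fin m) ℂ × Matrix (Fin m) (Fin n) ℂ × Matrix (Fin n) (Fin n) ℂ :=
    fun a => (a.1.map (starRingEnd ℂ), a.2.1.map (starRingEnd ℂ), a.2.2.map (starRingEnd ℂ))
  let P : ZMod p →
      Matrix (Fin m) (Fin m) ℂ × Matrix (Fin m) (Fin n) ℂ × Matrix (Fin n) (Fin n) ℂ → Prop :=
    fun k a => a.1 ∈ Matrix.unitaryGroup (Fin m) ℂ ∧ a.2.2 ∈ Matrix.unitaryGroup (Fin n) ℂ ∧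
      tFourier X k = a.1 * a.2.1 * a.2.2.conjTranspose ∧
      ∀ (i : Fin m) (j : Fin n), (i : ℕ) ≠ (j : ℕ) → a.2.1 i j = 0
  have hc : Function.Involutive c := fun a => by simp [c, Matrix.map_map, Function.comp_def]
  have hconj (k a) (ha : P k a) : P (-k) (c a) := by
    obtain ⟨U, S, V⟩ := a
    obtain ⟨hU, hV, hX, hS⟩ := ha
    refine ⟨Matrix.map_conj_mem_unitaryGroup hU, Matrix.map_conj_mem_unitaryGroup hV, ?_,
      fun i j hij => by simpa [c] using hS i j hij⟩
    rw [tFourier_neg, hX, Matrix.map_mul, Matrix.map_mul]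
    congr 1
  have hexists (k) : ∃ a, P k a ∧ (-k = k → c a = a) := by
    by_cases hk : -k = k
    · have hreal : tFourier X k = ((tFourier X k).map Complex.re).map Complex.ofRealHom := by
        have h := tFourier_neg X k
        rw [hk] at h
        ext i j
        exact (Complex.conj_eq_iff_re.mp (congrFun (congrFun h i) j).symm).symm
      obtain ⟨U, hU, S, V, hV, hX, hS⟩ :=
        ((tFourier X k).map Complex.re).exists_unitary_mul_diagonal
      refine ⟨(U.map Complex.ofRealHom, S.map Complex.ofRealHom, V.map Complex.ofRealHom),
        ⟨Matrix.map_ofReal_mem_unitaryGroup hU, Matrix.map_ofReal_mem_unitaryGroup hV, ?_,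
          fun i j hij => by simp [hS i j hij]⟩, fun _ => ?_⟩
      · rw [hreal, hX, Matrix.map_mul, Matrix.map_mul]
        congr 1
        ext i j
        simp
      · refine Prod.ext ?_ (Prod.ext ?_ ?_) <;> ext i j <;> simp [c]
    · obtain ⟨U, hU, S, V, hV, hX, hS⟩ := (tFourier X k).exists_unitary_mul_diagonal
      exact ⟨(U, S, V), ⟨hU, hV, hX, hS⟩, fun h => absurd h hk⟩
  obtain ⟨f, hf, hneg⟩ := ZMod.exists_forall_map_neg_eq hc hconj hexists
  refine ⟨tInvFourier fun k => (f k).1, tInvFourier fun k => (f k).2.1,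
    tInvFourier fun k => (f k).2.2, ?_⟩
  have hU := tFourier_tInvFourier (G := fun k => (f k).1) fun k => congrArg Prod.fst (hneg k)
  have hS := tFourier_tInvFourier (G := fun k => (f k).2.1) fun k =>
    congrArg (fun a => a.2.1) (hneg k)
  have hV := tFourier_tInvFourier (G := fun k => (f k).2.2) fun k =>
    congrArg (fun a => a.2.2) (hneg k)
  have hU' := tProd_tTranspose_self_of_tFourier_mem_unitaryGroup fun k => by
    rw [hU]
    exact (hf k).1
  have hV' := tProd_tTranspose_self_of_tFourier_mem_unitaryGroup fun k => by
    rw [hV]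
    exact (hf k).2.1
  refine ⟨tFourier_injective (funext fun k => ?_), hU'.1, hU'.2, hV'.1, hV'.2,
    tInvFourier_fDiagonal fun k => (hf k).2.2.2⟩
  rw [tFourier_tProd, tFourier_tProd, tFourier_tTranspose, hU, hS, hV]
  exact (hf k).2.2.1
end

section
/- Let ι and K be finite types, ρ > 0 a real number, β : K → ℝ with β k > 0 for all k, and let X, E, M : ι → ℝ and Z, P : K → ι → ℝ. Define L* : ι → ℝ by L*(i) = (ρ·(X i − E i + (M i)/ρ) + ∑_{k ∈ K} β k·(Z k i − (P k i)/(β k))) / (ρ + ∑_{k ∈ K} β k). Then L* is the unique minimizer over all L : ι → ℝ of the function L ↦ (ρ/2)·∑_{i} (X i − L i − E i + (M i)/ρ)² + ∑_{k ∈ K} (β k/2)·∑_{i} (L i − Z k i + (P k i)/(β k))². -/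
/-- Expansion of a weighted sum of squared distances around the weighted mean `y` of the centers. -/
theorem weighted_sq_sum_eq_add_sq {K : Type*} [Fintype K] (ρ a x y : ℝ) (β z : K → ℝ)
    (hy : (ρ + ∑ k, β k) * y = ρ * a + ∑ k, β k * z k) :
    (ρ / 2) * (a - x) ^ 2 + ∑ k, (β k / 2) * (x - z k) ^ 2 =
      ((ρ / 2) * (a - y) ^ 2 + ∑ k, (β k / 2) * (y - z k) ^ 2) +
        (ρ + ∑ k, β k) / 2 * (x - y) ^ 2 := by
  have h : ∑ k, (β k / 2) * (x - z k) ^ 2 =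
      ∑ k, (β k / 2) * (y - z k) ^ 2 + (∑ k, β k) * ((x - y) * y + (x - y) ^ 2 / 2) -
        (∑ k, β k * z k) * (x - y) := by
    rw [Finset.sum_mul, Finset.sum_mul, ← Finset.sum_add_distrib, ← Finset.sum_sub_distrib]
    exact Finset.sum_congr rfl fun k _ => by ring
  rw [h]
  linear_combination (x - y) * hy


/-- The closed-form `L*` is the unique minimizer of the strictly convex
quadratic objective of the low-rank-component subproblem (the `L`-update) in
the ADMM algorithm for the WSTNN-based TRPCA model. -/
theorem L_update_unique_minimizer
    {ι K : Type*} [Fintype ι] [Fintype K] (ρ : ℝ) (hρ : 0 < ρ)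
    (β : K → ℝ) (hβ : ∀ k, 0 < β k)
    (X E M : ι → ℝ) (Z P : K → ι → ℝ) (Lstar : ι → ℝ)
    (hLstar : ∀ i, Lstar i =
      (ρ * (X i - E i + M i / ρ) + ∑ k : K, β k * (Z k i - P k i / β k)) /
        (ρ + ∑ k : K, β k)) :
    (∀ L : ι → ℝ,
      (ρ / 2) * ∑ i, (X i - Lstar i - E i + M i / ρ) ^ 2 +
        ∑ k : K, (β k / 2) * ∑ i, (Lstar i - Z k i + P k i / β k) ^ 2 ≤
      (ρ / 2) * ∑ i, (X i - L i - E i + M i / ρ) ^ 2 +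
        ∑ k : K, (β k / 2) * ∑ i, (L i - Z k i + P k i / β k) ^ 2) ∧
    (∀ L : ι → ℝ,
      (ρ / 2) * ∑ i, (X i - Lstar i - E i + M i / ρ) ^ 2 +
        ∑ k : K, (β k / 2) * ∑ i, (Lstar i - Z k i + P k i / β k) ^ 2 =
      (ρ / 2) * ∑ i, (X i - L i - E i + M i / ρ) ^ 2 +
        ∑ k : K, (β k / 2) * ∑ i, (L i - Z k i + P k i / β k) ^ 2 → L = Lstar) := by
  have hpos : 0 < ρ + ∑ k, β k :=
    add_pos_of_pos_of_nonneg hρ (Finset.sum_nonneg fun k _ => (hβ k).le)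
  have swap (L : ι → ℝ) :
      (ρ / 2) * ∑ i, (X i - L i - E i + M i / ρ) ^ 2 +
        ∑ k : K, (β k / 2) * ∑ i, (L i - Z k i + P k i / β k) ^ 2 =
      ∑ i, ((ρ / 2) * (X i - E i + M i / ρ - L i) ^ 2 +
        ∑ k, (β k / 2) * (L i - (Z k i - P k i / β k)) ^ 2) := by
    simp_rw [Finset.mul_sum]
    rw [Finset.sum_comm, ← Finset.sum_add_distrib]
    refine Finset.sum_congr rfl fun i _ => ?_
    congr 1
    · ring
    · exact Finset.sum_congr rfl fun k _ => by ring
  have gap (L : ι → ℝ) :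
      (ρ / 2) * ∑ i, (X i - L i - E i + M i / ρ) ^ 2 +
        ∑ k : K, (β k / 2) * ∑ i, (L i - Z k i + P k i / β k) ^ 2 =
      ((ρ / 2) * ∑ i, (X i - Lstar i - E i + M i / ρ) ^ 2 +
        ∑ k : K, (β k / 2) * ∑ i, (Lstar i - Z k i + P k i / β k) ^ 2) +
      (ρ + ∑ k, β k) / 2 * ∑ i, (L i - Lstar i) ^ 2 := by
    rw [swap L, swap Lstar, Finset.mul_sum, ← Finset.sum_add_distrib]
    refine Finset.sum_congr rfl fun i _ => weighted_sq_sum_eq_add_sq _ _ _ _ _ _ ?_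
    rw [hLstar i, mul_div_cancel₀ _ hpos.ne']
  have hsq (L : ι → ℝ) : 0 ≤ ∑ i, (L i - Lstar i) ^ 2 :=
    Finset.sum_nonneg fun i _ => sq_nonneg _
  refine ⟨fun L => ?_, fun L hL => ?_⟩
  · rw [gap L]
    exact le_add_of_nonneg_right (mul_nonneg (half_pos hpos).le (hsq L))
  · rw [gap L, left_eq_add] at hL
    have hzero := (mul_eq_zero.mp hL).resolve_left (half_pos hpos).ne'
    rw [Finset.sum_eq_zero_iff_of_nonneg fun i _ => sq_nonneg _] at hzero
    funext i
    exact sub_eq_zero.mp (pow_eq_zero_iff two_ne_zero |>.mp (hzero i (Finset.mem_univ i)))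
end

section
/- Let ι and K be finite types with K nonempty, β : K → ℝ with β k > 0 for all k, Ω ⊆ ι a set of indices, F : ι → ℝ, and Y, M : K → ι → ℝ. Define X* : ι → ℝ by X*(i) = F i if i ∈ Ω, and X*(i) = (∑_{k ∈ K} β k·(Y k i − (M k i)/(β k))) / (∑_{k ∈ K} β k) if i ∉ Ω. Then X* satisfies the constraint X*(i) = F i for all i ∈ Ω, and for every X : ι → ℝ satisfying X i = F i for all i ∈ Ω, one has ∑_{k ∈ K} (β k/2)·∑_{i} (X* i − Y k i + (M k i)/(β k))² ≤ ∑_{k ∈ K} (β k/2)·∑_{i} (X i − Y k i + (M k i)/(β k))², with equality only when X = X*. -/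
/-- The parallel axis identity: a weighted sum of squared deviations from `x` is the one from the
weighted mean `m` plus the total weight times the squared distance between `x` and `m`. -/
theorem sum_weight_mul_sub_sq_eq {K : Type*} [Fintype K] (w c : K → ℝ) {m : ℝ}
    (hm : (∑ k, w k) * m = ∑ k, w k * c k) (x : ℝ) :
    ∑ k, w k * (x - c k) ^ 2 =
      ∑ k, w k * (m - c k) ^ 2 + (∑ k, w k) * (x - m) ^ 2 := by
  have h : ∑ k, w k * (x - c k) ^ 2 = ∑ k, w k * (m - c k) ^ 2 + (∑ k, w k) * (x - m) ^ 2 +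
      2 * (x - m) * ((∑ k, w k) * m - ∑ k, w k * c k) := by
    simp only [Finset.sum_mul, Finset.mul_sum, ← Finset.sum_sub_distrib, ← Finset.sum_add_distrib]
    exact Finset.sum_congr rfl fun k _ => by ring
  rw [h, hm]
  ring

/-- The closed-form `X*` (keeping the observed entries on `Ω` and averaging the
ADMM auxiliary variables elsewhere) solves the `X`-update subproblem in the
ADMM algorithm for the WSTNN-based LRTC model: it satisfies the observation
constraint and uniquely minimizes the quadratic objective among all tensors
satisfying the constraint. -/
theorem X_update_unique_minimizer
    {ι K : Type*} [Fintype ι] [Fintype K] [Nonempty K]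
    (β : K → ℝ) (hβ : ∀ k, 0 < β k)
    (Ω : Set ι) [DecidablePred (· ∈ Ω)]
    (F : ι → ℝ) (Y M : K → ι → ℝ) (Xstar : ι → ℝ)
    (hXstar : ∀ i, Xstar i =
      if i ∈ Ω then F i
      else (∑ k : K, β k * (Y k i - M k i / β k)) / (∑ k : K, β k)) :
    (∀ i ∈ Ω, Xstar i = F i) ∧
    (∀ X : ι → ℝ, (∀ i ∈ Ω, X i = F i) →
      (∑ k : K, (β k / 2) * ∑ i, (Xstar i - Y k i + M k i / β k) ^ 2 ≤
        ∑ k : K, (β k / 2) * ∑ i, (X i - Y k i + M k i / β k) ^ 2) ∧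
      (∑ k : K, (β k / 2) * ∑ i, (Xstar i - Y k i + M k i / β k) ^ 2 =
        ∑ k : K, (β k / 2) * ∑ i, (X i - Y k i + M k i / β k) ^ 2 → X = Xstar)) := by
  have hpos : 0 < ∑ k, β k := Finset.sum_pos (fun k _ => hβ k) Finset.univ_nonempty
  have hΩ : ∀ i ∈ Ω, Xstar i = F i := fun i hi => by rw [hXstar, if_pos hi]
  refine ⟨hΩ, fun X hX => ?_⟩
  have hentry : ∀ i, ∑ k, β k / 2 * (X i - Y k i + M k i / β k) ^ 2 =
      ∑ k, β k / 2 * (Xstar i - Y k i + M k i / β k) ^ 2 +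
        (∑ k, β k) / 2 * (X i - Xstar i) ^ 2 := by
    intro i
    by_cases hi : i ∈ Ω
    · simp [hX i hi, hΩ i hi]
    · have hm : (∑ k, β k / 2) * Xstar i = ∑ k, β k / 2 * (Y k i - M k i / β k) := by
        rw [hXstar, if_neg hi, ← Finset.sum_div]
        simp only [div_mul_eq_mul_div, ← Finset.sum_div]
        rw [mul_div_cancel₀ _ hpos.ne']
      simpa only [← sub_add, Finset.sum_div] using
        sum_weight_mul_sub_sq_eq (fun k => β k / 2) (fun k => Y k i - M k i / β k) hm (X i)
  have hobj : ∑ k, β k / 2 * ∑ i, (X i - Y k i + M k i / β k) ^ 2 =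
      ∑ k, β k / 2 * ∑ i, (Xstar i - Y k i + M k i / β k) ^ 2 +
        (∑ k, β k) / 2 * ∑ i, (X i - Xstar i) ^ 2 := by
    simp only [Finset.mul_sum]
    rw [Finset.sum_comm, Finset.sum_congr rfl fun i _ => hentry i, Finset.sum_add_distrib,
      Finset.sum_comm]
  rw [hobj]
  refine ⟨le_add_of_nonneg_right (by positivity), fun heq => ?_⟩
  have hzero : ∑ i, (X i - Xstar i) ^ 2 = 0 :=
    (mul_eq_zero.mp (left_eq_add.mp heq)).resolve_left (half_pos hpos).ne'
  rw [Finset.sum_eq_zero_iff_of_nonneg fun i _ => sq_nonneg _] at hzero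
  exact funext fun i =>
    sub_eq_zero.mp ((pow_eq_zero_iff two_ne_zero).mp (hzero i (Finset.mem_univ i)))
end
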